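/- Let d ≥ 2, let Γ ∈ 𝒟^d, and let Θ denote the upper-left d×d block of CM(Γ)⁻¹ (CM(Γ) being invertible for Γ ∈ 𝒟^d). Then for every k ∈ {1,…,d}, the Farris transform Σ^(k) is positive definite, and its inverse equals the (d−1)×(d−1) submatrix of Θ obtained by deleting row k and column k; that is, ((Σ^(k))⁻¹)_{ij} = Θ_{ij} for all i, j ≠ k. -/

import Mathlib

open Matrix

noncomputable section

/-- The Cayley–Menger matrix of a `d × d` matrix `Γ`: the `(d+1) × (d+1)` block matrix
`[[-Γ/2, 𝟙], [-𝟙ᵀ, 0]]`. -/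
def CM {d : ℕ} (Γ : Matrix (Fin d) (Fin d) ℝ) :
    Matrix (Fin (d + 1)) (Fin (d + 1)) ℝ :=
  Matrix.of fun i j =>
    if hi : (i : ℕ) < d then
      if hj : (j : ℕ) < d then -Γ ⟨i, hi⟩ ⟨j, hj⟩ / 2 else 1
    else if (j : ℕ) < d then -1 else 0

/-- The Farris transform `Σ^(k)` of `Γ`: the `(d-1) × (d-1)` matrix indexed by
`{1,…,d} \ {k}` with entries `Σ^(k)_{ij} = (Γ_{ik} + Γ_{jk} - Γ_{ij})/2`. -/
def farris {d : ℕ} (Γ : Matrix (Fin d) (Fin d) ℝ) (k : Fin d) :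
    Matrix {i : Fin d // i ≠ k} {i : Fin d // i ≠ k} ℝ :=
  Matrix.of fun i j =>
    (Γ (i : Fin d) k + Γ (j : Fin d) k - Γ (i : Fin d) (j : Fin d)) / 2

/-- The upper-left `d × d` block `Θ` of `CM(Γ)⁻¹`. -/
def cmTheta {d : ℕ} (Γ : Matrix (Fin d) (Fin d) ℝ) : Matrix (Fin d) (Fin d) ℝ :=
  Matrix.of fun i j => (CM Γ)⁻¹ i.castSucc j.castSucc

section CayleyMenger

variable {d : ℕ} {Γ : Matrix (Fin d) (Fin d) ℝ}

lemma sum_subtype_ne {ι : Type*} [Fintype ι] [DecidableEq ι] {k : ι} {f : ι → ℝ} (hf : f k = 0) :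
    ∑ i : {i : ι // i ≠ k}, f i = ∑ i, f i := by
  rw [Fintype.sum_eq_add_sum_subtype_ne f k, hf, zero_add]

@[simp] lemma CM_castSucc_castSucc (i j : Fin d) :
    CM Γ i.castSucc j.castSucc = -Γ i j / 2 := by
  simp [CM]

@[simp] lemma CM_castSucc_last (i : Fin d) : CM Γ i.castSucc (Fin.last d) = 1 := by
  simp [CM]

@[simp] lemma CM_last_castSucc (j : Fin d) : CM Γ (Fin.last d) j.castSucc = -1 := by
  simp [CM]

@[simp] lemma CM_last_last : CM Γ (Fin.last d) (Fin.last d) = 0 := by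
  simp [CM]

lemma isUnit_det_CM (hd : d ≠ 0)
    (hΓneg : ∀ x : Fin d → ℝ, x ≠ 0 → (∑ i, x i) = 0 → x ⬝ᵥ (Γ *ᵥ x) < 0) :
    IsUnit (CM Γ).det := by
  rw [isUnit_iff_ne_zero]
  intro hdet
  obtain ⟨v, hv, hCv⟩ := Matrix.exists_mulVec_eq_zero_iff.mpr hdet
  have hrow (i : Fin d) : ∑ j, Γ i j * v j.castSucc = 2 * v (Fin.last d) := by
    have h := congrFun hCv i.castSucc
    simp only [mulVec, dotProduct, Fin.sum_univ_castSucc, CM_castSucc_castSucc,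
      CM_castSucc_last, Pi.zero_apply, neg_div, neg_mul, div_mul_eq_mul_div,
      Finset.sum_neg_distrib, ← Finset.sum_div] at h
    linarith
  have hsum : ∑ j : Fin d, v j.castSucc = 0 := by
    have h := congrFun hCv (Fin.last d)
    simpa [mulVec, dotProduct, Fin.sum_univ_castSucc] using h
  have hx : (fun j : Fin d => v j.castSucc) = 0 := by
    by_contra hne
    have h := hΓneg _ hne hsum
    simp [mulVec, dotProduct, hrow, ← Finset.sum_mul, hsum] at h
  have hlast : v (Fin.last d) = 0 := by
    have h := hrow ⟨0, Nat.pos_of_ne_zero hd⟩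
    simp only [fun j : Fin d => show v j.castSucc = 0 from congrFun hx j, mul_zero,
      Finset.sum_const_zero] at h
    linarith
  refine hv (funext fun i => ?_)
  induction i using Fin.lastCases with
  | last => exact hlast
  | cast j => exact congrFun hx j

lemma sum_cmTheta (hCM : IsUnit (CM Γ).det) (j : Fin d) : ∑ l, cmTheta Γ l j = 0 := by
  have h := congrFun (congrFun (Matrix.mul_nonsing_inv _ hCM) (Fin.last d)) j.castSucc
  simpa [Matrix.mul_apply, Fin.sum_univ_castSucc, Matrix.one_apply, cmTheta,
    (Fin.castSucc_lt_last j).ne'] using h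

lemma sum_mul_cmTheta (hCM : IsUnit (CM Γ).det) (i j : Fin d) :
    ∑ l, Γ i l * cmTheta Γ l j =
      2 * ((CM Γ)⁻¹ (Fin.last d) j.castSucc - (1 : Matrix (Fin d) (Fin d) ℝ) i j) := by
  have h := congrFun (congrFun (Matrix.mul_nonsing_inv _ hCM) i.castSucc) j.castSucc
  simp only [Matrix.mul_apply, Fin.sum_univ_castSucc, CM_castSucc_castSucc, CM_castSucc_last,
    neg_div, neg_mul, div_mul_eq_mul_div, Finset.sum_neg_distrib, ← Finset.sum_div,
    Matrix.one_apply, Fin.castSucc_inj] at h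
  simp only [cmTheta, Matrix.of_apply, Matrix.one_apply]
  linarith

/-- Applying the Farris transform to the restriction of a vector with vanishing sum. -/
lemma farris_mulVec (hΓsym : Γ.IsSymm) (hΓdiag : ∀ i, Γ i i = 0) {k : Fin d} {x : Fin d → ℝ}
    (hx : ∑ i, x i = 0) (i : {i : Fin d // i ≠ k}) :
    (farris Γ k *ᵥ fun j => x j) i = ((Γ *ᵥ x) k - (Γ *ᵥ x) i) / 2 := by
  have hfull := sum_subtype_ne (k := k)
    (f := fun j => (Γ i k + Γ j k - Γ i j) / 2 * x j) (by simp [hΓdiag])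
  simp only [mulVec, dotProduct, farris, Matrix.of_apply]
  rw [hfull, ← Finset.sum_sub_distrib, Finset.sum_div]
  have hterm (j : Fin d) : (Γ i k + Γ j k - Γ i j) / 2 * x j =
      Γ i k / 2 * x j + (Γ k j * x j - Γ i j * x j) / 2 := by
    rw [hΓsym.apply k j]; ring
  simp only [hterm, Finset.sum_add_distrib, ← Finset.mul_sum, hx, mul_zero, zero_add]

lemma farris_posDef (hΓsym : Γ.IsSymm) (hΓdiag : ∀ i, Γ i i = 0)
    (hΓneg : ∀ x : Fin d → ℝ, x ≠ 0 → (∑ i, x i) = 0 → x ⬝ᵥ (Γ *ᵥ x) < 0) (k : Fin d) :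
    (farris Γ k).PosDef := by
  refine Matrix.PosDef.of_dotProduct_mulVec_pos ?_ fun y hy => ?_
  · ext i j
    simp only [farris, conjTranspose_apply, Matrix.of_apply, star_trivial]
    rw [hΓsym.apply (i : Fin d) j]; ring
  · let x : Fin d → ℝ := fun i => if h : i ≠ k then y ⟨i, h⟩ else -∑ j, y j
    have hxy (i : {i : Fin d // i ≠ k}) : x i = y i := by simp [x, i.2]
    have hxk : x k = -∑ j, y j := by simp [x]
    have hsum : ∑ i, x i = 0 := by
      simp [Fintype.sum_eq_add_sum_subtype_ne x k, hxk, hxy]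
    have hx0 : x ≠ 0 := fun h => hy (funext fun i => by rw [← hxy, h]; rfl)
    have hneg := hΓneg x hx0 hsum
    have hfull := sum_subtype_ne (k := k)
      (f := fun i => x i * (((Γ *ᵥ x) k - (Γ *ᵥ x) i) / 2)) (by simp)
    have hyx : y = fun i : {i : Fin d // i ≠ k} => x i := funext fun i => (hxy i).symm
    have hquad : star y ⬝ᵥ (farris Γ k *ᵥ y) = -(x ⬝ᵥ (Γ *ᵥ x)) / 2 := by
      rw [star_trivial, hyx]
      simp only [dotProduct, farris_mulVec hΓsym hΓdiag hsum]
      rw [hfull]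
      simp only [mul_div_assoc', mul_sub, ← Finset.sum_div, Finset.sum_sub_distrib,
        ← Finset.sum_mul, hsum, zero_mul, zero_sub]
    rw [hquad]
    linarith

lemma farris_mul_cmTheta (hΓsym : Γ.IsSymm) (hΓdiag : ∀ i, Γ i i = 0)
    (hCM : IsUnit (CM Γ).det) (k : Fin d) :
    farris Γ k * (cmTheta Γ).submatrix Subtype.val Subtype.val = 1 := by
  ext i j
  have h := farris_mulVec hΓsym hΓdiag (sum_cmTheta hCM j) i
  have hkj : k ≠ j := j.2.symm
  simp only [mulVec, dotProduct, sum_mul_cmTheta hCM] at h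
  simp only [Matrix.mul_apply, submatrix_apply, h, Matrix.one_apply, hkj, if_false,
    Subtype.ext_iff]
  ring

end CayleyMenger

/-- for `Γ ∈ 𝒟^d` and every `k`, the Farris transform `Σ^(k)` is
positive definite, and its inverse is the submatrix of the upper-left `d × d` block `Θ`
of `CM(Γ)⁻¹` obtained by deleting row and column `k`. -/
theorem statement2 {d : ℕ} (hd : 2 ≤ d)
    (Γ : Matrix (Fin d) (Fin d) ℝ)
    (hΓsym : Γ.IsSymm) (hΓdiag : ∀ i, Γ i i = 0)
    (hΓneg : ∀ x : Fin d → ℝ, x ≠ 0 → (∑ i, x i) = 0 → x ⬝ᵥ (Γ *ᵥ x) < 0) :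
    ∀ k : Fin d, (farris Γ k).PosDef ∧
      ∀ i j : {x : Fin d // x ≠ k},
        (farris Γ k)⁻¹ i j = cmTheta Γ (i : Fin d) (j : Fin d) := by
  intro k
  have hCM := isUnit_det_CM (by omega) hΓneg
  refine ⟨farris_posDef hΓsym hΓdiag hΓneg k, fun i j => ?_⟩
  rw [Matrix.inv_eq_right_inv (farris_mul_cmTheta hΓsym hΓdiag hCM k), submatrix_apply]
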